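/- arXiv:math/9902132 — 2 statements merged into one kernel-verified Lean document; each statement's English description precedes it below -/
import Mathlib

section
/- (Quillen's Trick) Let k be an infinite field, A a smooth k-algebra of Krull dimension d, 𝔭 a prime ideal of A, R = A_𝔭, and f ∈ 𝔭 a regular element of A. Suppose x_1, …, x_d ∈ A are algebraically independent over k and, with P = k[x_1, …, x_{d-1}] the k-subalgebra they generate: A/(f) is a finite P-module, the localization A_𝔭 is formally smooth over P, and A is a finite module over k[x_1, …, x_d]. Set S = A ⊗_P R, with i : R → S, r ↦ 1 ⊗ r, i_S : A → S, a ↦ a ⊗ 1, and let ε : S → R be the multiplication map a ⊗ r ↦ i_R(a)·r, where i_R : A → R is the canonical map. Then: (a) S is a finite module over the R-subalgebra of S generated by x_d ⊗ 1; (b) S/(f ⊗ 1) is a finite R-module; (c) ε ∘ i = id_R; (d) S is essentially smooth over k; and (e) the localization of S/𝔪_R S at the maximal ideal ε^{-1}(𝔪_R)/𝔪_R S is formally smooth over the residue field R/𝔪_R. -/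
open scoped TensorProduct

attribute [local instance] Algebra.TensorProduct.rightAlgebra

/-- Condition S3(b) for the extension `S/R` with augmentation `ε`: the localization of
`S/𝔪_R S` at the maximal ideal `ε⁻¹(𝔪_R)/𝔪_R S` is formally smooth over the residue
field `R/𝔪_R`. -/
def CondS3b (R S : Type) [CommRing R] [IsLocalRing R] [CommRing S] [Algebra R S]
    (ε : S →+* R) : Prop :=
  ∀ (𝔮 : Ideal (S ⧸ (IsLocalRing.maximalIdeal R).map (algebraMap R S)))
    (_ : 𝔮 = (((IsLocalRing.maximalIdeal R).comap ε).map
        (Ideal.Quotient.mk ((IsLocalRing.maximalIdeal R).map (algebraMap R S)))))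
    (hq : 𝔮.IsPrime),
    letI := hq
    letI : Algebra (R ⧸ IsLocalRing.maximalIdeal R) (Localization 𝔮.primeCompl) :=
      ((algebraMap (S ⧸ (IsLocalRing.maximalIdeal R).map (algebraMap R S))
          (Localization 𝔮.primeCompl)).comp
        (Ideal.quotientMap ((IsLocalRing.maximalIdeal R).map (algebraMap R S))
          (algebraMap R S) Ideal.le_comap_map)).toAlgebra
    Algebra.FormallySmooth (R ⧸ IsLocalRing.maximalIdeal R) (Localization 𝔮.primeCompl)

namespace Algebra.FormallySmooth

/-- Let `R` be a localization of `A` that is formally smooth over `P`. Then every localization of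
`A ⊗[P] K` that factors through `R ⊗[P] K` is formally smooth over `K`. -/
theorem of_isLocalization_tensorProduct {P A R K L : Type*} [CommRing P] [CommRing A] [CommRing R]
    [CommRing K] [CommRing L] [Algebra P A] [Algebra P R] [Algebra A R] [IsScalarTower P A R]
    [Algebra P K] [Algebra K L] [Algebra (A ⊗[P] K) L] [IsScalarTower K (A ⊗[P] K) L]
    [FormallySmooth P R] (M : Submonoid A) [IsLocalization M R]
    (N : Submonoid (A ⊗[P] K)) [IsLocalization N L] (hMN : algebraMapSubmonoid (A ⊗[P] K) M ≤ N) :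
    FormallySmooth K L := by
  let φ : A ⊗[P] K →ₐ[P] R ⊗[P] K :=
    TensorProduct.map (IsScalarTower.toAlgHom P A R) (AlgHom.id P K)
  let : Algebra (A ⊗[P] K) (R ⊗[P] K) := φ.toRingHom.toAlgebra
  have : IsScalarTower A (A ⊗[P] K) (R ⊗[P] K) := .of_algebraMap_eq fun a ↦ by
    change algebraMap A R a ⊗ₜ[P] (1 : K) = φ (a ⊗ₜ[P] 1)
    simp [φ]
  have : IsScalarTower K (A ⊗[P] K) (R ⊗[P] K) := .of_algebraMap_eq fun c ↦ by
    change (1 : R) ⊗ₜ[P] c = φ (1 ⊗ₜ[P] c)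
    simp [φ]
  have : IsLocalization (algebraMapSubmonoid (A ⊗[P] K) M) (R ⊗[P] K) :=
    IsLocalization.tensorProduct_tensorProduct P K M R <| RingHom.ext fun c ↦ by
      change φ (1 ⊗ₜ[P] c) = 1 ⊗ₜ[P] c
      simp [φ]
  let ψ : R ⊗[P] K →+* L := IsLocalization.lift (R := A ⊗[P] K) (M := algebraMapSubmonoid (A ⊗[P] K) M)
    (g := algebraMap (A ⊗[P] K) L) fun y ↦ IsLocalization.map_units L (⟨y, hMN y.2⟩ : N)
  let : Algebra (R ⊗[P] K) L := ψ.toAlgebra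
  have : IsScalarTower (A ⊗[P] K) (R ⊗[P] K) L :=
    .of_algebraMap_eq fun y ↦ (IsLocalization.lift_eq _ y).symm
  have : IsScalarTower K (R ⊗[P] K) L := .to₁₃₄ K (A ⊗[P] K) (R ⊗[P] K) L
  have := IsLocalization.isLocalization_of_submonoid_le (R ⊗[P] K) L _ N hMN
  have : FormallySmooth (R ⊗[P] K) L := of_isLocalization (N.map (algebraMap _ (R ⊗[P] K)))
  have : FormallySmooth K (R ⊗[P] K) :=
    .of_equiv { TensorProduct.comm P K R with
      commutes' := fun c ↦ by
        change TensorProduct.comm P K R (c ⊗ₜ 1) = 1 ⊗ₜ c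
        simp }
  exact .comp K (R ⊗[P] K) L

end Algebra.FormallySmooth

/-- Let `J` be the ideal of `A ⊗[P] R` generated by an ideal `I` of a localization `R` of `A` that
is formally smooth over `P`. Every localization of `(A ⊗[P] R) / J` in which the denominators of
`R` are inverted is formally smooth over `R / I`. -/
theorem Algebra.FormallySmooth.of_isLocalization_quotient {P A R L : Type*} [CommRing P]
    [CommRing A] [CommRing R] [CommRing L] [Algebra P A] [Algebra P R] [Algebra A R]
    [IsScalarTower P A R] [Algebra.FormallySmooth P R] (M : Submonoid A) [IsLocalization M R]
    (I : Ideal R) [Algebra (R ⧸ I) L]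
    [Algebra ((A ⊗[P] R) ⧸ I.map (algebraMap R (A ⊗[P] R))) L]
    (h : ∀ r : R, algebraMap (R ⧸ I) L (Ideal.Quotient.mk I r) =
      algebraMap ((A ⊗[P] R) ⧸ I.map (algebraMap R (A ⊗[P] R))) L
        (Ideal.Quotient.mk _ (1 ⊗ₜ[P] r)))
    (N : Submonoid ((A ⊗[P] R) ⧸ I.map (algebraMap R (A ⊗[P] R)))) [IsLocalization N L]
    (hMN : ∀ a ∈ M, Ideal.Quotient.mk _ (a ⊗ₜ[P] (1 : R)) ∈ N) :
    Algebra.FormallySmooth (R ⧸ I) L := by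
  let e : A ⊗[P] (R ⧸ I) ≃+* (A ⊗[P] R) ⧸ I.map (algebraMap R (A ⊗[P] R)) :=
    (Algebra.TensorProduct.tensorQuotientEquiv A R A I).toRingEquiv
  let : Algebra (A ⊗[P] (R ⧸ I)) L :=
    ((algebraMap ((A ⊗[P] R) ⧸ I.map (algebraMap R (A ⊗[P] R))) L).comp
      e.symm.symm.toRingHom).toAlgebra
  have : IsScalarTower (R ⧸ I) (A ⊗[P] (R ⧸ I)) L := .of_algebraMap_eq fun c ↦ by
    obtain ⟨r, rfl⟩ := Ideal.Quotient.mk_surjective c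
    exact h r
  have := IsLocalization.isLocalization_of_base_ringEquiv N L e.symm
  refine .of_isLocalization_tensorProduct (P := P) (R := R) M (N.map e.symm) ?_
  rintro _ ⟨a, ha, rfl⟩
  exact ⟨_, hMN a ha, e.symm_apply_eq.mpr rfl⟩

theorem condS3b_of_formallySmooth {P A R : Type} [CommRing P] [CommRing A] [CommRing R]
    [IsLocalRing R] [Algebra P A] [Algebra P R] [Algebra A R] [IsScalarTower P A R]
    [Algebra.FormallySmooth P R] (M : Submonoid A) [IsLocalization M R] :
    CondS3b R (A ⊗[P] R) (Algebra.TensorProduct.productMap (IsScalarTower.toAlgHom P A R)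
      (AlgHom.id P R) : A ⊗[P] R →+* R) := by
  intro 𝔮 h𝔮 hq
  let ε := Algebra.TensorProduct.productMap (IsScalarTower.toAlgHom P A R) (AlgHom.id P R)
  refine @Algebra.FormallySmooth.of_isLocalization_quotient P A R (Localization 𝔮.primeCompl)
    _ _ _ _ _ _ _ _ _ M _ _ (_) _ (fun r ↦ rfl) 𝔮.primeCompl _ fun a ha ↦ ?_
  have hε : (IsLocalRing.maximalIdeal R).map (algebraMap R (A ⊗[P] R)) ≤
      (IsLocalRing.maximalIdeal R).comap (ε : A ⊗[P] R →+* R) := by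
    refine Ideal.map_le_iff_le_comap.mpr fun r hr ↦ ?_
    change ε ((1 : A) ⊗ₜ[P] r) ∈ IsLocalRing.maximalIdeal R
    simpa [ε] using hr
  change Ideal.Quotient.mk _ (a ⊗ₜ 1) ∉ 𝔮
  rw [h𝔮, Ideal.mem_quotient_iff_mem hε]
  simpa [ε] using IsLocalization.map_units R (⟨a, ha⟩ : M)

namespace Module.Finite

/-- If `A` is finite over `P[x]`, then `A ⊗[P] R` is finite over `R[x ⊗ 1]`. -/
theorem adjoin_tmul_one {P A : Type*} (R : Type*) [CommRing P] [CommRing A] [CommRing R]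
    [Algebra P A] [Algebra P R] (x : A) [hx : Module.Finite (Algebra.adjoin P {x}) A] :
    Module.Finite (Algebra.adjoin R {(x ⊗ₜ[P] (1 : R) : A ⊗[P] R)}) (A ⊗[P] R) := by
  classical
  obtain ⟨s, hs⟩ := hx.fg_top
  let B := Algebra.adjoin R {(x ⊗ₜ[P] (1 : R) : A ⊗[P] R)}
  have hB (c : A) (hc : c ∈ Algebra.adjoin P {x}) (r : R) : c ⊗ₜ[P] r ∈ B := by
    have h : Algebra.adjoin P {x} ≤ (B.restrictScalars P).comap
        (Algebra.TensorProduct.includeLeft : A →ₐ[P] A ⊗[P] R) :=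
      Algebra.adjoin_le <| Set.singleton_subset_iff.mpr <|
        Algebra.subset_adjoin (Set.mem_singleton (x ⊗ₜ[P] (1 : R)))
    simpa [Algebra.TensorProduct.right_algebraMap_apply] using
      B.mul_mem (h hc) (B.algebraMap_mem r)
  refine ⟨s.image (· ⊗ₜ[P] 1), Submodule.eq_top_iff'.mpr fun y ↦ ?_⟩
  induction y with
  | zero => exact zero_mem _
  | add y z hy hz => exact add_mem hy hz
  | tmul a r =>
    have ha : a ∈ Submodule.span (Algebra.adjoin P {x}) (s : Set A) := hs ▸ trivial
    induction ha using Submodule.span_induction generalizing r with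
    | zero => simp
    | add a b _ _ ha hb => rw [TensorProduct.add_tmul]; exact add_mem (ha r) (hb r)
    | smul c a _ ha =>
      have := Submodule.smul_mem _ (⟨c.1 ⊗ₜ r, hB _ c.2 r⟩ : B) (ha 1)
      simpa [Subalgebra.smul_def] using this
    | mem a ha =>
      have ha' : a ⊗ₜ[P] (1 : R) ∈ s.image (· ⊗ₜ[P] (1 : R)) := Finset.mem_image_of_mem _ ha
      have := Submodule.smul_mem _ (⟨1 ⊗ₜ r, hB _ (one_mem _) r⟩ : B)
        (Submodule.subset_span (Finset.mem_coe.mpr ha'))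
      simpa [Subalgebra.smul_def] using this

/-- If `A / fA` is finite over `P`, then `(A ⊗[P] R) / (f ⊗ 1)` is finite over `R`. -/
theorem quotient_span_tmul_one {P A : Type*} (R : Type*) [CommRing P] [CommRing A] [CommRing R]
    [Algebra P A] [Algebra P R] (f : A) [Module.Finite P (A ⧸ Ideal.span {f})] :
    Module.Finite R ((A ⊗[P] R) ⧸ Ideal.span {(f ⊗ₜ[P] (1 : R) : A ⊗[P] R)}) := by
  let I := Ideal.span {(f ⊗ₜ[P] (1 : R) : A ⊗[P] R)}
  let g : A ⧸ Ideal.span {f} →ₐ[P] (A ⊗[P] R) ⧸ I :=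
    Ideal.quotientMapₐ I Algebra.TensorProduct.includeLeft <| by
      rw [Ideal.span_singleton_le_iff_mem]
      exact Ideal.subset_span rfl
  let φ : R ⊗[P] (A ⧸ Ideal.span {f}) →ₐ[R] (A ⊗[P] R) ⧸ I :=
    Algebra.TensorProduct.lift (Algebra.ofId R _) g fun _ _ ↦ .all _ _
  refine .of_surjective φ.toLinearMap fun y ↦ ?_
  obtain ⟨y, rfl⟩ := Ideal.Quotient.mk_surjective y
  induction y with
  | zero => exact ⟨0, by simp⟩
  | add y z hy hz =>
    obtain ⟨y', hy⟩ := hy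
    obtain ⟨z', hz⟩ := hz
    exact ⟨y' + z', by rw [map_add, hy, hz, map_add]⟩
  | tmul a r =>
    refine ⟨r ⊗ₜ Ideal.Quotient.mk _ a, ?_⟩
    change algebraMap R _ r * Ideal.Quotient.mk I (a ⊗ₜ 1) = _
    change Ideal.Quotient.mk I (1 ⊗ₜ r) * Ideal.Quotient.mk I (a ⊗ₜ 1) = _
    rw [← map_mul, Algebra.TensorProduct.tmul_mul_tmul, one_mul, mul_one]

/-- If `A` is finite over a subalgebra, it is finite over every larger one, even when the base
rings differ. -/
theorem of_subalgebra_le {k P A : Type*} [CommRing k] [CommRing P] [CommRing A] [Algebra k A]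
    [Algebra P A] {B : Subalgebra k A} {C : Subalgebra P A} (h : ∀ a ∈ B, a ∈ C)
    [Module.Finite B A] : Module.Finite C A := by
  let φ : B →+* C := B.val.toRingHom.codRestrict C fun b ↦ h _ b.2
  let : Algebra B C := φ.toAlgebra
  have : IsScalarTower B C A := .of_algebraMap_eq fun _ ↦ rfl
  exact .of_restrictScalars_finite B C A

end Module.Finite

/-- Adjoining the last of `d` elements to the algebra generated by the others gives the algebra
generated by all of them. -/
theorem Algebra.adjoin_range_subset_adjoin_last {k A : Type*} [CommRing k] [CommRing A]
    [Algebra k A] {d : ℕ} (hd : d - 1 < d) (x : Fin d → A) :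
    ∀ a ∈ Algebra.adjoin k (Set.range x),
      a ∈ Algebra.adjoin (Algebra.adjoin k (x '' {i | (i : ℕ) < d - 1})) {x ⟨d - 1, hd⟩} := by
  suffices Algebra.adjoin k (Set.range x) ≤ (Algebra.adjoin
      (Algebra.adjoin k (x '' {i | (i : ℕ) < d - 1})) {x ⟨d - 1, hd⟩}).restrictScalars k from
    fun a ha ↦ this ha
  refine Algebra.adjoin_le ?_
  rintro _ ⟨i, rfl⟩
  by_cases hi : (i : ℕ) < d - 1
  · exact Subalgebra.algebraMap_mem _
      (⟨x i, Algebra.subset_adjoin ⟨i, hi, rfl⟩⟩ : Algebra.adjoin k (x '' {i | (i : ℕ) < d - 1}))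
  · obtain rfl : i = ⟨d - 1, hd⟩ := Fin.ext (by grind)
    exact Algebra.self_mem_adjoin_singleton (Algebra.adjoin k (x '' {i | (i : ℕ) < d - 1})) _

set_option synthInstance.maxHeartbeats 1000000 in
set_option maxHeartbeats 1000000 in
/-- **Quillen's Trick.**  Let `A` be a smooth `k`-algebra of Krull dimension `d`, `𝔭` a prime
of `A`, `R = A_𝔭`, and `f ∈ 𝔭` a regular element.  Given `x 0, …, x (d-1)` algebraically
independent over `k` such that, with `P` the subalgebra generated by the first `d - 1` of
them, `A/(f)` is finite over `P`, `A_𝔭` is formally smooth over `P` and `A` is finite over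
`k[x 0, …, x (d-1)]`, the algebra `S = A ⊗_P R` (with `i = includeRight`,
`i_S = includeLeft` and the multiplication augmentation `ε`) satisfies: (a) `S` is finite
over the `R`-subalgebra generated by `x_d ⊗ 1`; (b) `S/(f ⊗ 1)` is a finite `R`-module;
(c) `ε ∘ i = id`; (d) `S` is essentially smooth over `k`; (e) condition S3(b). -/
theorem quillen_trick
    (k : Type) [Field k] [Infinite k]
    (A : Type) [CommRing A] [Algebra k A] [Algebra.Smooth k A]
    (d : ℕ) (hd0 : 0 < d) (hdim : ringKrullDim A = d)
    (𝔭 : Ideal A) [𝔭.IsPrime]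
    (f : A) (hf𝔭 : f ∈ 𝔭) (hf : f ∈ nonZeroDivisors A)
    (x : Fin d → A) (hx : AlgebraicIndependent k x)
    (hfin : Module.Finite (Algebra.adjoin k (x '' {i | (i : ℕ) < d - 1}))
      (A ⧸ Ideal.span {f}))
    (hsm : Algebra.FormallySmooth (Algebra.adjoin k (x '' {i | (i : ℕ) < d - 1}))
      (Localization.AtPrime 𝔭))
    (hfin' : Module.Finite (Algebra.adjoin k (Set.range x)) A) :
    -- (a)
    Module.Finite
      (Algebra.adjoin (Localization.AtPrime 𝔭)
        {((x ⟨d - 1, by omega⟩ ⊗ₜ[Algebra.adjoin k (x '' {i | (i : ℕ) < d - 1})] 1) :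
          A ⊗[Algebra.adjoin k (x '' {i | (i : ℕ) < d - 1})] Localization.AtPrime 𝔭)})
      (A ⊗[Algebra.adjoin k (x '' {i | (i : ℕ) < d - 1})] Localization.AtPrime 𝔭) ∧
    -- (b)
    Module.Finite (Localization.AtPrime 𝔭)
      ((A ⊗[Algebra.adjoin k (x '' {i | (i : ℕ) < d - 1})] Localization.AtPrime 𝔭) ⧸
        Ideal.span {((f ⊗ₜ[Algebra.adjoin k (x '' {i | (i : ℕ) < d - 1})] 1) :
          A ⊗[Algebra.adjoin k (x '' {i | (i : ℕ) < d - 1})] Localization.AtPrime 𝔭)}) ∧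
    -- (c)
    (∀ r : Localization.AtPrime 𝔭,
      Algebra.TensorProduct.productMap
        (IsScalarTower.toAlgHom (Algebra.adjoin k (x '' {i | (i : ℕ) < d - 1})) A
          (Localization.AtPrime 𝔭))
        (AlgHom.id (Algebra.adjoin k (x '' {i | (i : ℕ) < d - 1})) (Localization.AtPrime 𝔭))
        ((1 : A) ⊗ₜ[Algebra.adjoin k (x '' {i | (i : ℕ) < d - 1})] r) = r) ∧
    -- (d)
    (Algebra.FormallySmooth k
        (A ⊗[Algebra.adjoin k (x '' {i | (i : ℕ) < d - 1})] Localization.AtPrime 𝔭) ∧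
      Algebra.EssFiniteType k
        (A ⊗[Algebra.adjoin k (x '' {i | (i : ℕ) < d - 1})] Localization.AtPrime 𝔭)) ∧
    -- (e)
    CondS3b (Localization.AtPrime 𝔭)
      (A ⊗[Algebra.adjoin k (x '' {i | (i : ℕ) < d - 1})] Localization.AtPrime 𝔭)
      (Algebra.TensorProduct.productMap
        (IsScalarTower.toAlgHom (Algebra.adjoin k (x '' {i | (i : ℕ) < d - 1})) A
          (Localization.AtPrime 𝔭))
        (AlgHom.id (Algebra.adjoin k (x '' {i | (i : ℕ) < d - 1}))
          (Localization.AtPrime 𝔭)) : _ →+* Localization.AtPrime 𝔭) := by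
  let P := Algebra.adjoin k (x '' {i | (i : ℕ) < d - 1})
  refine ⟨?_, .quotient_span_tmul_one _ f, fun r ↦ ?_, ⟨?_, ?_⟩, ?_⟩
  · have : Module.Finite (Algebra.adjoin P {x ⟨d - 1, by omega⟩}) A :=
      .of_subalgebra_le (Algebra.adjoin_range_subset_adjoin_last (by omega) x)
    exact .adjoin_tmul_one _ _
  · simp
  · exact .comp k A (A ⊗[P] Localization.AtPrime 𝔭)
  · have : Algebra.EssFiniteType P (Localization.AtPrime 𝔭) := .of_comp k P _
    exact .comp k A (A ⊗[P] Localization.AtPrime 𝔭)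
  · exact condS3b_of_formallySmooth 𝔭.primeCompl
end

section
/- Let R be a commutative local ring in which 2 is a unit and whose residue field is infinite. Let A be an R-algebra equipped with an R-linear involution σ (an additive, R-linear anti-automorphism of A with σ ∘ σ = id). Let C be the center of A. Assume: σ maps C to itself and the fixed subring {c ∈ C : σ(c) = c} equals the image of R in A; C is an étale R-algebra that is finitely generated projective of constant rank 2 as an R-module; and A is an Azumaya algebra over C. Then for every a ∈ A with a·σ(a) = 1 there exists a unit b ∈ A^× such that a = b·σ(b)^{-1}. -/
open scoped TensorProduct

/-- The center of an `R`-algebra acts on it by multiplication, making `A` an algebra over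
its center. -/
noncomputable instance centerAlgebra (R A : Type) [CommRing R] [Ring A] [Algebra R A] :
    Algebra (Subalgebra.center R A) A :=
  RingHom.toAlgebra' ((Subalgebra.center R A).val : _ →+* A)
    (fun c x => (Subalgebra.mem_center_iff.mp c.2 x).symm)

/-- The canonical homomorphism `A ⊗_C Aᵐᵒᵖ → End_C A`, sending `a ⊗ b` to `x ↦ a * x * b`. -/
noncomputable def azumayaMap (C A : Type) [CommRing C] [Ring A] [Algebra C A] :
    A ⊗[C] Aᵐᵒᵖ →ₗ[C] (A →ₗ[C] A) :=
  TensorProduct.lift (LinearMap.mk₂ C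
    (fun a b => (LinearMap.mulLeft C a).comp (LinearMap.mulRight C b.unop))
    (fun a a' b => by ext x; simp [add_mul])
    (fun c a b => by ext x; simp [smul_mul_assoc])
    (fun a b b' => by ext x; simp [mul_add])
    (fun c a b => by ext x; simp [mul_smul_comm]))

open Polynomial in
/-- If `p` annihilates `w` and `p(x)` is a unit, then `w - x` is a unit. -/
theorem isUnit_sub_algebraMap_of_aeval_eq_zero {R A : Type*} [CommRing R] [Ring A] [Algebra R A]
    {w : A} {p : R[X]} (hp : aeval w p = 0) {x : R} (hx : IsUnit (p.eval x)) :
    IsUnit (w - algebraMap R A x) := by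
  obtain ⟨q, hq⟩ := X_sub_C_dvd_sub_C_eval (p := p) (a := x)
  have h := congrArg (aeval w) hq
  simp only [map_sub, map_mul, hp, aeval_X, aeval_C, zero_sub] at h
  have hcomm : Commute (w - algebraMap R A x) (aeval w q) := by
    have h' := congrArg (aeval w) (mul_comm (X - C x) q)
    simp only [map_sub, map_mul, aeval_X, aeval_C] at h'
    exact h'
  have hu : IsUnit ((w - algebraMap R A x) * aeval w q) := by
    rw [← h]
    exact (hx.map (algebraMap R A)).neg
  exact (hcomm.isUnit_mul_iff.mp hu).1

open Polynomial Classical in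
/-- Over a local ring with infinite residue field in which `2` is a unit, the pencil
`2 (1 + t² d) + (1 - t² d) w` through an integral element `w` contains a unit when `d` is one. -/
theorem exists_isUnit_pencil {R A : Type*} [CommRing R] [IsLocalRing R]
    [Infinite (IsLocalRing.ResidueField R)] [Ring A] [Algebra R A] (h2 : IsUnit (2 : R))
    {d : R} (hd : IsUnit d) {w : A} (hw : IsIntegral R w) :
    ∃ t : R, IsUnit (algebraMap R A (2 * (1 + t ^ 2 * d)) +
      algebraMap R A (1 - t ^ 2 * d) * w) := by
  obtain ⟨p, hpm, hp⟩ := hw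
  let k := IsLocalRing.ResidueField R
  let res : R →+* k := IsLocalRing.residue R
  have hd0 : res d ≠ 0 := (hd.map res).ne_zero
  have h20 : (2 : k) ≠ 0 := by simpa only [map_ofNat] using (h2.map res).ne_zero
  have hpb : (p.map res) ≠ 0 := (hpm.map res).ne_zero
  have hq : ∀ y : k, (C (res d) * X ^ 2 - C y : k[X]) ≠ 0 := fun y h => by
    have h' := congrArg (fun f : k[X] => f.coeff 2) h
    simp at h'
    exact hd0 h'
  -- The parameters to avoid: `d t² = 1`, and for each root `r` the two solutions of
  -- `(2 - r) d t² = - 2 - r`.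
  let bad : Finset k := (C (res d) * X ^ 2 - C 1).roots.toFinset ∪
    (p.map res).roots.toFinset.biUnion fun r =>
      (C (res d) * X ^ 2 - C ((-2 - r) / (2 - r)) : k[X]).roots.toFinset
  obtain ⟨t', ht'⟩ := Infinite.exists_notMem_finset bad
  obtain ⟨t, rfl⟩ := IsLocalRing.residue_surjective t'
  change res t ∉ bad at ht'
  simp only [bad, Finset.mem_union, Finset.mem_biUnion, Multiset.mem_toFinset, mem_roots (hq _),
    mem_roots hpb, IsRoot.def, eval_sub, eval_mul, eval_C, eval_pow, eval_X, not_or, not_exists,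
    not_and] at ht'
  obtain ⟨ht1, ht2⟩ := ht'
  have hv : IsUnit (1 - t ^ 2 * d) := by
    refine (IsLocalRing.residue_ne_zero_iff_isUnit _).mp fun h => ht1 ?_
    change res (1 - t ^ 2 * d) = 0 at h
    simp only [map_sub, map_one, map_mul, map_pow] at h
    linear_combination -h
  obtain ⟨v, hv⟩ := hv
  let x : R := -(2 * (1 + t ^ 2 * d)) * (v⁻¹ : Rˣ)
  have hxv : (v : R) * x = -(2 * (1 + t ^ 2 * d)) := by
    simp only [x]
    rw [mul_left_comm, Units.mul_inv, mul_one]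
  have hxu : IsUnit (p.eval x) := by
    refine (IsLocalRing.residue_ne_zero_iff_isUnit _).mp fun h => ?_
    have hr : (p.map res).eval (res x) = 0 := by rw [eval_map_apply]; exact h
    refine ht2 _ hr ?_
    have e := congrArg res hxv
    rw [hv] at e
    simp only [map_sub, map_one, map_mul, map_pow, map_neg, map_add, map_ofNat] at e
    have h2x : (2 : k) - res x ≠ 0 := fun h0 => by
      have : res x = 2 := by linear_combination -h0
      rw [this] at e
      exact mul_ne_zero h20 h20 (by linear_combination e)
    rw [sub_eq_zero, eq_div_iff h2x]
    linear_combination e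
  refine ⟨t, ?_⟩
  have hu := (v.isUnit.map (algebraMap R A)).mul (isUnit_sub_algebraMap_of_aeval_eq_zero hp hxu)
  rw [mul_sub, ← map_mul, hxv, hv, map_neg, sub_neg_eq_add, add_comm] at hu
  exact hu

/-- An étale quadratic algebra over a local ring that is spanned by the scalars and by elements
with scalar square contains such an element with invertible square. -/
theorem exists_isUnit_sq_of_etale {R C : Type*} [CommRing R] [IsLocalRing R] [CommRing C]
    [Algebra R C] [Algebra.Etale R C] [Module.Finite R C] [Module.Projective R C]
    (hrank : Module.finrank R C = 2) (P : C → Prop)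
    (hdecomp : ∀ c : C, ∃ r θ, P θ ∧ c = algebraMap R C r + θ)
    (hsq : ∀ θ, P θ → ∃ s, θ ^ 2 = algebraMap R C s) :
    ∃ θ s, P θ ∧ IsUnit s ∧ θ ^ 2 = algebraMap R C s := by
  by_contra! hcon
  let k := IsLocalRing.ResidueField R
  have : Module.Free R C := Module.free_of_flat_of_isLocalRing
  have hred : IsReduced (k ⊗[R] C) := Algebra.FormallyUnramified.isReduced_of_field k _
  have hzero : ∀ θ, P θ → (1 : k) ⊗ₜ[R] θ = 0 := fun θ hθ => by
    obtain ⟨s, hs⟩ := hsq θ hθ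
    have hs0 : algebraMap R k s = 0 := by
      by_contra h
      exact hcon θ s hθ ((IsLocalRing.residue_ne_zero_iff_isUnit s).mp h) hs
    refine eq_zero_of_pow_eq_zero (n := 2) ?_
    rw [Algebra.TensorProduct.tmul_pow, hs, one_pow, Algebra.algebraMap_eq_smul_one,
      ← TensorProduct.smul_tmul, Algebra.smul_def, hs0, zero_mul, TensorProduct.zero_tmul]
  have hle : Module.finrank k (k ⊗[R] C) ≤ 1 := by
    refine finrank_le_one (1 : k ⊗[R] C) fun x => ?_
    induction x with
    | zero => exact ⟨0, zero_smul _ _⟩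
    | add x y hx hy =>
      obtain ⟨a, rfl⟩ := hx
      obtain ⟨b, rfl⟩ := hy
      exact ⟨a + b, add_smul _ _ _⟩
    | tmul y c =>
      obtain ⟨r, θ, hθ, rfl⟩ := hdecomp c
      refine ⟨r • y, ?_⟩
      have h0 : y ⊗ₜ[R] θ = 0 := by
        have := congrArg (y • ·) (hzero θ hθ)
        simpa [TensorProduct.smul_tmul'] using this
      rw [TensorProduct.tmul_add, h0, add_zero, Algebra.algebraMap_eq_smul_one,
        ← TensorProduct.smul_tmul, Algebra.TensorProduct.one_def, TensorProduct.smul_tmul',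
        smul_eq_mul, mul_one]
  rw [Module.finrank_baseChange, hrank] at hle
  omega

/-- **Unitary Hilbert 90 for Azumaya algebras.**  Let `R` be a local ring in which `2` is a
unit and with infinite residue field, and let `(A, σ)` be an Azumaya algebra with unitary
involution over `R`: `σ` is an `R`-linear involution of `A`, the center `C` of `A` is stable
under `σ` with fixed subring the image of `R`, `C` is an étale quadratic `R`-algebra (finitely
generated projective of rank `2`), and `A` is an Azumaya algebra over `C` (faithful, finitely
generated projective as a `C`-module, with bijective canonical map `A ⊗_C Aᵐᵒᵖ → End_C A`).
Then every `a ∈ A` with `a·σ(a) = 1` has the form `a = b·σ(b)⁻¹` for some unit `b`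
(equivalently, `a·σ(b) = b`). -/
theorem unitary_hilbert_ninety
    (R : Type) [CommRing R] [IsLocalRing R]
    (h2 : IsUnit (2 : R)) [Infinite (IsLocalRing.ResidueField R)]
    (A : Type) [Ring A] [Algebra R A]
    (σ : A →ₗ[R] A)
    (hanti : ∀ x y : A, σ (x * y) = σ y * σ x)
    (hinvol : ∀ x : A, σ (σ x) = x)
    (hcenter : ∀ c ∈ Subalgebra.center R A, σ c ∈ Subalgebra.center R A)
    (hfixed : ∀ c ∈ Subalgebra.center R A, (σ c = c ↔ ∃ r : R, algebraMap R A r = c))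
    (hetale : Algebra.Etale R (Subalgebra.center R A))
    (hfinC : Module.Finite R (Subalgebra.center R A))
    (hprojC : Module.Projective R (Subalgebra.center R A))
    (hrankC : Module.finrank R (Subalgebra.center R A) = 2)
    (hfaith : FaithfulSMul (Subalgebra.center R A) A)
    (hfinA : Module.Finite (Subalgebra.center R A) A)
    (hprojA : Module.Projective (Subalgebra.center R A) A)
    (hbij : Function.Bijective (azumayaMap (Subalgebra.center R A) A))
    (a : A) (ha : a * σ a = 1) :
    ∃ b : A, IsUnit b ∧ a * σ b = b := by
  let C := Subalgebra.center R A
  have : IsScalarTower R C A := ⟨fun r c x => smul_mul_assoc r (c : A) x⟩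
  have : Module.Finite R A := Module.Finite.trans C A
  have hσ1 : σ 1 = 1 := by simpa [hinvol] using (hanti (σ 1) 1).symm
  have ha' : σ a * a = 1 := by
    have hsurj : Function.Surjective (LinearMap.mulLeft R a) := fun y =>
      ⟨σ a * y, by simp [← mul_assoc, ha]⟩
    refine OrzechProperty.injective_of_surjective_endomorphism _ hsurj ?_
    simp [← mul_assoc, ha]
  obtain ⟨θ, d, hθ, hd, hθd⟩ := exists_isUnit_sq_of_etale (R := R) (C := C) hrankC
    (fun θ => σ θ = -θ)
    (fun c => by
      obtain ⟨e, he⟩ := h2.map (algebraMap R C)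
      obtain ⟨u, hu⟩ := h2
      have hmem := hcenter c c.2
      obtain ⟨r, hr⟩ := (hfixed (c + σ c) (add_mem c.2 hmem)).mp (by
        rw [map_add, hinvol, add_comm])
      have hhalf : ∀ x : A, (↑u⁻¹ : R) • x + (↑u⁻¹ : R) • x = x := fun x => by
        rw [← two_smul R, ← hu, smul_smul, Units.mul_inv, one_smul]
      refine ⟨(↑u⁻¹ : R) * r, (↑u⁻¹ : R) • (c - ⟨σ c, hmem⟩), ?_, ?_⟩
      · change σ ((↑u⁻¹ : R) • ((c : A) - σ c)) = -((↑u⁻¹ : R) • ((c : A) - σ c))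
        rw [map_smul, map_sub, hinvol, ← smul_neg, neg_sub]
      · apply Subtype.ext
        change (c : A) = algebraMap R A ((↑u⁻¹ : R) * r) + (↑u⁻¹ : R) • ((c : A) - σ c)
        rw [map_mul, hr, ← Algebra.smul_def, ← smul_add]
        conv_lhs => rw [← hhalf (c : A)]
        rw [← smul_add]
        congr 1
        abel)
    (fun θ hθ => by
      obtain ⟨s, hs⟩ := (hfixed ((θ : A) * θ) (mul_mem θ.2 θ.2)).mp (by
        rw [hanti, hθ, neg_mul_neg])
      exact ⟨s, Subtype.ext (by rw [sq]; exact hs.symm)⟩)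
  obtain ⟨t, ht⟩ := exists_isUnit_pencil h2 hd (IsIntegral.of_finite R (a + σ a))
  obtain ⟨τ, hτ⟩ : ∃ τ : A, τ = t • (θ : A) := ⟨_, rfl⟩
  have hτσ : σ τ = -τ := by rw [hτ, map_smul, hθ, smul_neg]
  have hτc : ∀ x : A, x * τ = τ * x := fun x => by
    rw [hτ, mul_smul_comm, smul_mul_assoc, Subalgebra.mem_center_iff.mp θ.2]
  have hττ : τ * τ = algebraMap R A (t ^ 2 * d) := by
    have hθd' : (θ : A) * θ = algebraMap R A d := by
      rw [← sq]
      exact congrArg Subtype.val hθd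
    rw [hτ, smul_mul_smul_comm, hθd', ← sq, Algebra.smul_def, map_mul]
  have hprod : ∀ x y : A, x * y = 1 →
      ((1 + x) + τ * (1 - x)) * ((1 + y) + τ * (1 - y)) =
        algebraMap R A (2 * (1 + t ^ 2 * d)) + algebraMap R A (1 - t ^ 2 * d) * (x + y) := by
    intro x y hxy
    have hcross : (1 + x) * (τ * (1 - y)) = τ * ((1 + x) * (1 - y)) := by
      rw [← mul_assoc, hτc, mul_assoc]
    have hdiag : τ * (1 - x) * (τ * (1 - y)) = τ * τ * ((1 - x) * (1 - y)) := by
      rw [mul_assoc, ← mul_assoc (1 - x), hτc, mul_assoc, mul_assoc]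
    have e1 : (1 + x) * (1 + y) = 2 + (x + y) := by
      simp only [add_mul, mul_add, hxy, one_mul, mul_one, ← one_add_one_eq_two]; abel
    have e2 : (1 - x) * (1 - y) = 2 - (x + y) := by
      simp only [sub_mul, mul_sub, hxy, one_mul, mul_one, ← one_add_one_eq_two]; abel
    have e3 : (1 + x) * (1 - y) + (1 - x) * (1 + y) = 0 := by
      simp only [sub_mul, mul_sub, add_mul, mul_add, hxy, one_mul, mul_one]; abel
    calc _ = (1 + x) * (1 + y) + τ * ((1 + x) * (1 - y) + (1 - x) * (1 + y))
          + τ * τ * ((1 - x) * (1 - y)) := by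
          rw [add_mul, mul_add (1 + x) (1 + y), mul_add (τ * (1 - x)), hcross, hdiag, mul_assoc τ,
            mul_add τ]
          abel
      _ = _ := by
          rw [e1, e2, e3, hττ]
          simp only [map_mul, map_add, map_sub, map_one, map_ofNat, mul_sub, mul_add, sub_mul,
            one_mul, mul_one, two_mul, mul_two, mul_zero]
          abel
  refine ⟨(1 + a) + τ * (1 - a), ?_, ?_⟩
  · have hb := hprod a (σ a) ha
    have hb' := hprod (σ a) a ha'
    rw [add_comm (σ a) a, ← hb] at hb'
    rw [← hb] at ht
    exact ((show Commute _ _ from hb'.symm).isUnit_mul_iff.mp ht).1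
  · rw [map_add, map_add, hanti, map_sub, hσ1, hτσ, mul_neg, hτc, mul_add, mul_add, ha, mul_neg,
      ← mul_assoc, hτc, mul_assoc, mul_sub, ha]
    noncomm_ring
end
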